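/- Let Π_− be the set of signed permutation words π ∈ Π(G) whose last letter is negative, and for each i let v_i = #{π ∈ Π_− : des(π) = i}. Then the sequence (v_0, v_1, …, v_{d−1}) is symmetric: v_i = v_{d−1−i} for 0 ≤ i ≤ d−1, and it is unimodal: v_0 ≤ v_1 ≤ … ≤ v_{⌊(d−1)/2⌋}. -/

import Mathlib

open Set Pointwise

/-- The fractional stable set polytope `FRAC(G)` of a finite simple graph `G` on `Fin d`. -/
def FRAC (d : ℕ) (G : SimpleGraph (Fin d)) : Set (Fin d → ℝ) :=
  {x | (∀ i, 0 ≤ x i) ∧ ∀ i j, G.Adj i j → x i + x j ≤ 1}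

/-- The polytope `Q(G) = 3·FRAC(G) − (1,…,1)`. -/
def Qpoly (d : ℕ) (G : SimpleGraph (Fin d)) : Set (Fin d → ℝ) :=
  {x | (∀ i, -1 ≤ x i) ∧ ∀ i j, G.Adj i j → x i + x j ≤ 1}

/-- The number of lattice points of a subset of `ℝ^d`. -/
noncomputable def latticePts {d : ℕ} (s : Set (Fin d → ℝ)) : ℕ :=
  (s ∩ {x | ∀ i, ∃ z : ℤ, x i = (z : ℝ)}).ncard

/-- `π : Fin d → ℤ` is a signed permutation word on `[d] = {1,…,d}`:
each letter is one of `±1,…,±d` and the absolute values form a permutation of `1,…,d`. -/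
def IsSignedPermWord (d : ℕ) (π : Fin d → ℤ) : Prop :=
  (∀ p, 1 ≤ (π p).natAbs ∧ (π p).natAbs ≤ d) ∧
    Function.Injective fun p => (π p).natAbs

/-- The number of descents of a signed permutation word: position `i` (0-based) is a
descent if `i` is not the last position and `π i > π (i+1)`, or `i` is the last
position and `π i > 0`. -/
noncomputable def des {d : ℕ} (π : Fin d → ℤ) : ℕ :=
  Set.ncard {i : Fin d |
    (∃ h : (i : ℕ) + 1 < d, π ⟨(i : ℕ) + 1, h⟩ < π i) ∨ ((i : ℕ) + 1 = d ∧ 0 < π i)}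

/-- Steingrímsson's set `Π(G)`: signed permutation words such that for every edge
`(i,j)` of `G`, if the letter `+i` appears then the letter `−j` precedes it.
(Vertex `v : Fin d` corresponds to the letter `v+1`.) -/
def PiSet {d : ℕ} (G : SimpleGraph (Fin d)) : Set (Fin d → ℤ) :=
  {π | IsSignedPermWord d π ∧ ∀ i j : Fin d, G.Adj i j →
    ∀ p : Fin d, π p = ((i : ℕ) + 1 : ℤ) →
      ∃ q : Fin d, q < p ∧ π q = -(((j : ℕ) + 1 : ℤ))}

/-- The dual (polar) of a subset of `ℝ^d`. -/
def polarDual {d : ℕ} (P : Set (Fin d → ℝ)) : Set (Fin d → ℝ) :=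
  {x | ∀ y ∈ P, (∑ i, x i * y i) ≤ 1}

/-- The vertex set `{e_i + e_j : (i,j) ∈ E(G)} ∪ {−e_1,…,−e_d}` of the dual of `Q(G)`. -/
def Vset (d : ℕ) (G : SimpleGraph (Fin d)) : Set (Fin d → ℝ) :=
  {x | ∃ i j, G.Adj i j ∧ x = Pi.single i 1 + Pi.single j 1} ∪
    {x | ∃ i, x = -Pi.single i 1}

/-- The Eulerian number `A(k,i)`: the number of permutations of `{1,…,k}` with
exactly `i` descents. -/
noncomputable def eulerianNumber (k i : ℕ) : ℕ :=
  Set.ncard {σ : Equiv.Perm (Fin k) |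
    Set.ncard {j : Fin k | ∃ h : (j : ℕ) + 1 < k, σ ⟨(j : ℕ) + 1, h⟩ < σ j} = i}

/-- The configuration `A ⊂ ℤ^{d+1}` consisting of `(0,1)`, `(e_i+e_j,1)` for edges
`(i,j)`, and `(−e_i,1)`. -/
def Aset (d : ℕ) (G : SimpleGraph (Fin d)) : Set (Fin (d + 1) → ℤ) :=
  {a | a = Fin.snoc (0 : Fin d → ℤ) (1 : ℤ) ∨
    (∃ i j, G.Adj i j ∧ a = Fin.snoc (Pi.single i 1 + Pi.single j 1) (1 : ℤ)) ∨
    ∃ i, a = Fin.snoc (-Pi.single i 1) (1 : ℤ)}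

open Polynomial in
/-- gamma-positive polynomials with centre N/2 -/
noncomputable def Gam (N : ℕ) : AddSubmonoid (Polynomial ℕ) :=
  AddSubmonoid.closure {p | ∃ a b, 2 * a + b = N ∧ p = X ^ a * (1 + X) ^ b}

open Polynomial in
lemma Gam_basic {N : ℕ} (a b : ℕ) (h : 2 * a + b = N) :
    (X ^ a * (1 + X) ^ b : Polynomial ℕ) ∈ Gam N :=
  AddSubmonoid.subset_closure ⟨a, b, h, rfl⟩

lemma Gam_mul {M N K : ℕ} {p q : Polynomial ℕ} (hp : p ∈ Gam M) (hq : q ∈ Gam N)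
    (hK : M + N = K) : p * q ∈ Gam K := by
  subst hK
  induction hp using AddSubmonoid.closure_induction with
  | zero => simp [(Gam (M+N)).zero_mem]
  | add x y _ _ hx hy => rw [add_mul]; exact (Gam _).add_mem hx hy
  | mem x hx =>
    obtain ⟨a, b, h, rfl⟩ := hx
    induction hq using AddSubmonoid.closure_induction with
    | zero => simp [(Gam (M+N)).zero_mem]
    | add x y _ _ hx hy => rw [mul_add]; exact (Gam _).add_mem hx hy
    | mem y hy =>
      obtain ⟨a', b', h', rfl⟩ := hy
      have := Gam_basic (N := M + N) (a + a') (b + b') (by omega)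
      convert this using 1
      ring

open Polynomial in
lemma Gam_one : (1 : Polynomial ℕ) ∈ Gam 0 := by
  simpa using Gam_basic (N := 0) 0 0 rfl

open Polynomial in
lemma Gam_X : (X : Polynomial ℕ) ∈ Gam 2 := by
  simpa using Gam_basic (N := 2) 1 0 rfl

open Polynomial in
lemma Gam_oneX : (1 + X : Polynomial ℕ) ∈ Gam 1 := by
  simpa using Gam_basic (N := 1) 0 1 rfl

open Polynomial in
lemma Gam_spec {N : ℕ} {p : Polynomial ℕ} (hp : p ∈ Gam N) :
    (∀ i ≤ N, p.coeff i = p.coeff (N - i)) ∧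
      (∀ i, i + 1 ≤ N / 2 → p.coeff i ≤ p.coeff (i + 1)) := by
  induction hp using AddSubmonoid.closure_induction with
  | zero => simp
  | add x y _ _ hx hy =>
    refine ⟨fun i hi => ?_, fun i hi => ?_⟩
    · simp [hx.1 i hi, hy.1 i hi]
    · simp only [coeff_add]; exact add_le_add (hx.2 i hi) (hy.2 i hi)
  | mem x hx =>
    obtain ⟨a, b, h, rfl⟩ := hx
    have key : ∀ i, (X ^ a * (1 + X) ^ b : Polynomial ℕ).coeff i =
        if a ≤ i then b.choose (i - a) else 0 := by
      intro i
      rw [coeff_X_pow_mul', coeff_one_add_X_pow]; simp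
    refine ⟨fun i hi => ?_, fun i hi => ?_⟩
    · rw [key, key]
      split_ifs with h1 h2 h2
      · rw [← Nat.choose_symm (n := b) (k := i - a) (by omega)]; congr 1; omega
      · exact Nat.choose_eq_zero_of_lt (by omega)
      · exact (Nat.choose_eq_zero_of_lt (by omega)).symm
      · rfl
    · rw [key, key]
      split_ifs with h1 h2 h2
      · have := Nat.choose_le_succ_of_lt_half_left (n := b) (r := i - a) (by omega)
        rwa [show i - a + 1 = i + 1 - a by omega] at this
      · omega
      · omega
      · rfl

/-- descents of a list (no boundary convention) -/
def desL : List ℤ → ℕ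
  | [] => 0
  | [_] => 0
  | a :: b :: l => (if b < a then 1 else 0) + desL (b :: l)

lemma desL_append (u : List ℤ) (a b : ℤ) (v : List ℤ) :
    desL (u ++ a :: b :: v) = desL (u ++ [a]) + (if b < a then 1 else 0) + desL (b :: v) := by
  induction u with
  | nil => simp [desL]
  | cons c u ih =>
    cases u with
    | nil => simp [desL]; ring
    | cons e u => simp only [List.cons_append, desL] at ih ⊢; rw [ih]; ring

lemma desL_asc (u v : List ℤ) (h : ∀ a ∈ u, ∀ b ∈ v.head?, a < b) :
    desL (u ++ v) = desL u + desL v := by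
  rcases List.eq_nil_or_concat u with rfl | ⟨u, a, rfl⟩
  · simp [desL]
  cases v with
  | nil => simp [desL]
  | cons b v =>
    have := desL_append u a b v
    have h' : ¬ b < a := not_lt.2 (h a (by simp) b (by simp)).le
    simp [h'] at this
    simpa using this

lemma desL_desc (u v : List ℤ) (hu : u ≠ []) (hv : v ≠ []) (h : ∀ a ∈ u, ∀ b ∈ v.head?, b < a) :
    desL (u ++ v) = desL u + 1 + desL v := by
  rcases List.eq_nil_or_concat u with rfl | ⟨u, a, rfl⟩
  · simp at hu
  cases v with
  | nil => simp at hv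
  | cons b v =>
    have := desL_append u a b v
    have h' : b < a := (h a (by simp) b (by simp))
    simp [h'] at this
    simpa using this

/-- lists enumerating a finset -/
noncomputable def permsF (S : Finset ℤ) : Finset (List ℤ) := S.val.lists.toFinset

lemma mem_permsF {S : Finset ℤ} {w : List ℤ} : w ∈ permsF S ↔ w.Nodup ∧ w.toFinset = S := by
  unfold permsF
  rw [Multiset.mem_toFinset, Multiset.mem_lists_iff]
  constructor
  · intro h
    change S.val = (w : Multiset ℤ) at h
    have hn : w.Nodup := by rw [← Multiset.coe_nodup, ← h]; exact S.nodup
    refine ⟨hn, ?_⟩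
    ext x; rw [List.mem_toFinset, ← Multiset.mem_coe, ← h]; simp
  · rintro ⟨hn, rfl⟩
    simp [List.dedup_eq_self.2 hn]

open Polynomial in
noncomputable def gf (T : Finset (List ℤ)) : Polynomial ℕ := ∑ w ∈ T, X ^ desL w

/-- suffix sets -/
noncomputable def sufF (p : ℤ → Bool) (W : Finset (List ℤ)) (T : Finset ℤ) : Finset (List ℤ) :=
  (W.filter (fun w => (w.takeWhile p).toFinset = T)).image (List.dropWhile p)

lemma takeWhile_app (p : ℤ → Bool) (u v : List ℤ) (hu : ∀ a ∈ u, p a = true)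
    (hv : ∀ a ∈ v.head?, p a = false) : (u ++ v).takeWhile p = u ∧ (u ++ v).dropWhile p = v := by
  induction u with
  | nil =>
    cases v with
    | nil => simp
    | cons b v => simp at hv; simp [hv]
  | cons c u ih =>
    have h1 := hu c (by simp)
    have h2 := ih (fun a ha => hu a (by simp [ha]))
    simp [h1, h2]

lemma mem_sufF {p : ℤ → Bool} {W : Finset (List ℤ)} {T : Finset ℤ} {v : List ℤ} :
    v ∈ sufF p W T ↔ ∃ u, u ++ v ∈ W ∧ (∀ a ∈ u, p a = true) ∧ u.toFinset = T ∧
      (∀ a ∈ v.head?, p a = false) := by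
  unfold sufF
  simp only [Finset.mem_image, Finset.mem_filter]
  constructor
  · rintro ⟨w, ⟨hw, hT⟩, rfl⟩
    refine ⟨w.takeWhile p, by simpa using hw, fun a ha => ?_, hT, fun a ha => ?_⟩
    · exact List.mem_takeWhile_imp ha
    · have := List.head?_dropWhile_not p w
      simp at ha
      rw [ha] at this
      simpa using this
  · rintro ⟨u, hw, hu, hT, hv⟩
    obtain ⟨h1, h2⟩ := takeWhile_app p u v hu hv
    exact ⟨u ++ v, ⟨hw, by rw [h1, hT]⟩, h2⟩

lemma split_sum (p : ℤ → Bool) (W : Finset (List ℤ)) (hnd : ∀ w ∈ W, w.Nodup)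
    (hcl : ∀ u u' v : List ℤ, (∀ a ∈ u, p a = true) → u.Perm u' → u ++ v ∈ W → u' ++ v ∈ W)
    (f : List ℤ → Polynomial ℕ) :
    ∑ w ∈ W, f w = ∑ T ∈ W.image (fun w => (w.takeWhile p).toFinset),
      ∑ u ∈ permsF T, ∑ v ∈ sufF p W T, f (u ++ v) := by
  rw [← Finset.sum_fiberwise_of_maps_to (t := W.image (fun w => (w.takeWhile p).toFinset))
    (g := fun w => (w.takeWhile p).toFinset) (fun w hw => Finset.mem_image_of_mem _ hw)]
  refine Finset.sum_congr rfl fun T _ => ?_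
  rw [← Finset.sum_product']
  have key : ∀ u v, u ∈ permsF T → v ∈ sufF p W T → u ++ v ∈ W ∧ (∀ a ∈ u, p a = true) ∧
      (∀ a ∈ v.head?, p a = false) := by
    intro u v hu hv
    obtain ⟨u0, h0, h1, h2, h3⟩ := mem_sufF.1 hv
    obtain ⟨hun, huT⟩ := mem_permsF.1 hu
    have h0n : u0.Nodup := (List.nodup_append.1 (hnd _ h0)).1
    have hp : u0.Perm u := by
      rw [List.perm_ext_iff_of_nodup h0n hun]
      intro a; rw [← List.mem_toFinset, ← List.mem_toFinset, h2, huT]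
    exact ⟨hcl u0 u v h1 hp h0, fun a ha => h1 a (hp.mem_iff.2 ha), h3⟩
  refine Finset.sum_bij' (fun w _ => (w.takeWhile p, w.dropWhile p)) (fun x _ => x.1 ++ x.2)
    ?_ ?_ ?_ ?_ ?_
  · intro w hw
    obtain ⟨hw, hT⟩ := Finset.mem_filter.1 hw
    refine Finset.mem_product.2 ⟨mem_permsF.2 ⟨?_, hT⟩, ?_⟩
    · exact (hnd w hw).sublist (List.takeWhile_sublist p)
    · exact Finset.mem_image_of_mem _ (Finset.mem_filter.2 ⟨hw, hT⟩)
  · rintro ⟨u, v⟩ hx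
    obtain ⟨hu, hv⟩ := Finset.mem_product.1 hx
    obtain ⟨h1, h2, h3⟩ := key u v hu hv
    refine Finset.mem_filter.2 ⟨h1, ?_⟩
    simp only [(takeWhile_app p u v h2 h3).1]
    exact (mem_permsF.1 hu).2
  · intro w hw; simp
  · rintro ⟨u, v⟩ hx
    obtain ⟨hu, hv⟩ := Finset.mem_product.1 hx
    obtain ⟨h1, h2, h3⟩ := key u v hu hv
    simp [takeWhile_app p u v h2 h3]
  · intro w hw; simp

open Polynomial in
lemma Eul_mem (n : ℕ) : ∀ S : Finset ℤ, S.card = n + 1 → gf (permsF S) ∈ Gam n := by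
  induction n using Nat.strong_induction_on with
  | _ n ih =>
  intro S hS
  have hne : S.Nonempty := by rw [← Finset.card_pos]; omega
  obtain ⟨m, hmS, hmax⟩ : ∃ m ∈ S, ∀ a ∈ S, a ≤ m :=
    ⟨S.max' hne, S.max'_mem hne, fun a ha => S.le_max' a ha⟩
  set p : ℤ → Bool := fun a => decide (a ≠ m) with hp
  have hsuf : ∀ T ∈ (permsF S).image (fun w => (w.takeWhile p).toFinset),
      T ⊆ S.erase m ∧ sufF p (permsF S) T = (permsF (S.erase m \ T)).image (List.cons m) := by
    intro T hT
    obtain ⟨w, hw, rfl⟩ := Finset.mem_image.1 hT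
    obtain ⟨hwn, hwS⟩ := mem_permsF.1 hw
    refine ⟨?_, ?_⟩
    · intro a ha
      rw [List.mem_toFinset] at ha
      have h1 := List.mem_takeWhile_imp ha
      have h2 := (List.takeWhile_sublist p).subset ha
      rw [← List.mem_toFinset, hwS] at h2
      simp [hp] at h1
      simp [h1, h2]
    · have hTp : ∀ a ∈ w.takeWhile p, p a = true := fun a ha => List.mem_takeWhile_imp ha
      have hTn : (w.takeWhile p).Nodup := hwn.sublist (List.takeWhile_sublist p)
      have hTS : ∀ a ∈ w.takeWhile p, a ∈ S := fun a ha => by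
        rw [← hwS, List.mem_toFinset]; exact (List.takeWhile_sublist p).subset ha
      generalize w.takeWhile p = t at hTp hTn hTS
      ext v
      rw [mem_sufF, Finset.mem_image]
      constructor
      · rintro ⟨u, h1, h2, h3, h4⟩
        obtain ⟨hun, huS⟩ := mem_permsF.1 h1
        rw [← h3]
        cases v with
        | nil =>
          exfalso
          rw [← huS] at hmS
          simp at hmS
          have := h2 m hmS
          simp [hp] at this
        | cons c v =>
          simp [hp] at h4
          subst h4
          refine ⟨v, mem_permsF.2 ⟨?_, ?_⟩, rfl⟩
          · exact (List.nodup_cons.1 (List.nodup_append.1 hun).2.1).2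
          · rw [← huS]
            ext x
            simp [List.nodup_append] at hun
            simp
            grind
      · rintro ⟨v, hv, rfl⟩
        obtain ⟨hvn, hvS⟩ := mem_permsF.1 hv
        have hv' : ∀ x, x ∈ v ↔ (x ≠ m ∧ x ∈ S) ∧ x ∉ t := by
          intro x; rw [← List.mem_toFinset, hvS]; simp
        refine ⟨t, mem_permsF.2 ⟨?_, ?_⟩, hTp, rfl, by simp [hp]⟩
        · simp [hp] at hTp
          simp [List.nodup_append]
          grind
        · ext x
          simp
          grind
  have himg : (permsF S).image (fun w => (w.takeWhile p).toFinset) = (S.erase m).powerset := by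
    ext T
    constructor
    · intro hT; exact Finset.mem_powerset.2 (hsuf T hT).1
    · intro hT
      rw [Finset.mem_powerset] at hT
      have hTm : ∀ a ∈ T, a ≠ m ∧ a ∈ S := fun a ha => by simpa using hT ha
      refine Finset.mem_image.2 ⟨T.toList ++ m :: (S.erase m \ T).toList, mem_permsF.2 ⟨?_, ?_⟩, ?_⟩
      · simp [List.nodup_append, Finset.nodup_toList]
        grind
      · ext x; simp; grind
      · rw [(takeWhile_app p T.toList _ ?_ ?_).1]
        · simp
        · intro a ha; simp at ha; simp [hp, (hTm a ha).1]
        · simp [hp]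
  have hg : gf (permsF S) = ∑ T ∈ (S.erase m).powerset, gf (permsF T) *
      (gf (permsF (S.erase m \ T)) * if S.erase m \ T = ∅ then 1 else X) := by
    unfold gf
    rw [split_sum p (permsF S) (fun w hw => (mem_permsF.1 hw).1) ?_, himg]
    · refine Finset.sum_congr rfl fun T hT => ?_
      rw [(hsuf T (himg ▸ hT)).2, Finset.sum_mul]
      refine Finset.sum_congr rfl fun u hu => ?_
      rw [Finset.sum_image (by intro a _ b _ h; simpa using h), Finset.sum_mul, Finset.mul_sum]
      refine Finset.sum_congr rfl fun v hv => ?_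
      obtain ⟨hun, huS⟩ := mem_permsF.1 hu
      obtain ⟨hvn, hvS⟩ := mem_permsF.1 hv
      have hu1 : desL (u ++ [m]) = desL u := by
        rw [desL_asc]
        · simp [desL]
        · intro a ha b hb
          simp at hb; subst hb
          rw [← List.mem_toFinset, huS] at ha
          have := Finset.mem_powerset.1 hT ha
          simp at this
          exact lt_of_le_of_ne (hmax a this.2) this.1
      cases v with
      | nil =>
        simp at hvS
        rw [if_pos hvS.symm, hu1]; simp [desL]
      | cons c v =>
        have hc : c ∈ S.erase m \ T := by rw [← hvS]; simp
        have hc' : c < m := by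
          simp at hc
          exact lt_of_le_of_ne (hmax c hc.1.2) hc.1.1
        rw [if_neg (Finset.ne_empty_of_mem hc), desL_append, if_pos hc', hu1]
        ring
    · intro u u' v _ hpu h
      obtain ⟨h1, h2⟩ := mem_permsF.1 h
      have hq : (u ++ v).Perm (u' ++ v) := hpu.append_right v
      exact mem_permsF.2 ⟨hq.nodup_iff.1 h1, by rw [← h2]; exact (List.toFinset_eq_of_perm _ _ hq).symm⟩
  have hE0 : gf (permsF ∅) = 1 := by
    have : permsF ∅ = {[]} := by
      ext w; rw [mem_permsF]; simp; rintro rfl; simp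
    simp [gf, this, desL]
  have hS' : (S.erase m).card = n := by rw [Finset.card_erase_of_mem hmS]; omega
  rw [hg]
  rcases Nat.eq_zero_or_pos n with rfl | hn
  · have : S.erase m = ∅ := Finset.card_eq_zero.1 hS'
    rw [this]
    simp [hE0, Gam_one]
  · have hne' : S.erase m ≠ ∅ := by intro h; rw [h] at hS'; simp at hS'; omega
    have hfull := ih (n - 1) (by omega) (S.erase m) (by omega)
    rw [← Finset.add_sum_erase _ _ (Finset.empty_mem_powerset (S.erase m)),
      ← Finset.add_sum_erase _ _ (Finset.mem_erase.2 ⟨hne', Finset.mem_powerset_self (S.erase m)⟩),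
      ← add_assoc]
    refine (Gam n).add_mem ?_ ((Gam n).sum_mem fun T hT => ?_)
    · simp only [Finset.sdiff_empty, Finset.sdiff_self, hE0, if_neg hne', if_true]
      have := Gam_mul (K := n) Gam_oneX hfull (by omega)
      convert this using 1
      ring
    · simp only [Finset.mem_erase, Finset.mem_powerset] at hT
      obtain ⟨hT1, hT2, hT3⟩ := hT
      have hc := Finset.card_sdiff_add_card_eq_card hT3
      have hTpos : 0 < T.card := Finset.card_pos.2 (Finset.nonempty_iff_ne_empty.2 hT2)
      have hne2 : S.erase m \ T ≠ ∅ := by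
        intro h
        exact hT1 (Finset.Subset.antisymm hT3 (Finset.sdiff_eq_empty_iff_subset.1 h))
      have hDpos : 0 < (S.erase m \ T).card := Finset.card_pos.2 (Finset.nonempty_iff_ne_empty.2 hne2)
      rw [if_neg hne2]
      have e1 := ih (T.card - 1) (by omega) T (by omega)
      have e2 := ih ((S.erase m \ T).card - 1) (by omega) _ (by omega : (S.erase m \ T).card = _)
      exact Gam_mul e1 (Gam_mul e2 Gam_X rfl) (by omega)

/-- closed under swapping adjacent letters of equal sign -/
def SwapClosed (W : Finset (List ℤ)) : Prop :=
  ∀ (u : List ℤ) (a b : ℤ) (v : List ℤ), (a < 0 ↔ b < 0) → u ++ a :: b :: v ∈ W →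
    u ++ b :: a :: v ∈ W

lemma SwapClosed.perm {W : Finset (List ℤ)} (h : SwapClosed W) {m m' : List ℤ} (hm : m.Perm m') :
    ∀ (u v : List ℤ), (∀ a ∈ m, ∀ b ∈ m, (a < 0 ↔ b < 0)) → u ++ (m ++ v) ∈ W →
      u ++ (m' ++ v) ∈ W := by
  induction hm with
  | nil => intro u v _ h; exact h
  | cons x _ ih =>
    intro u v hs hw
    have := ih (u ++ [x]) v (fun a ha b hb => hs a (by simp [ha]) b (by simp [hb])) (by simpa using hw)
    simpa using this
  | swap x y l =>
    intro u v hs hw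
    exact h u y x (l ++ v) (hs y (by simp) x (by simp)) hw
  | trans h1 _ ih1 ih2 =>
    intro u v hs hw
    refine ih2 u v ?_ (ih1 u v hs hw)
    intro a ha b hb
    exact hs a (h1.mem_iff.2 ha) b (h1.mem_iff.2 hb)

lemma SwapClosed.suf {W : Finset (List ℤ)} (h : SwapClosed W) (p : ℤ → Bool)
    (hp : ∀ a b : ℤ, (a < 0 ↔ b < 0) → p a = p b) (T : Finset ℤ) : SwapClosed (sufF p W T) := by
  intro x a b y hab hv
  obtain ⟨u, h1, h2, h3, h4⟩ := mem_sufF.1 hv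
  refine mem_sufF.2 ⟨u, ?_, h2, h3, ?_⟩
  · have := h (u ++ x) a b y hab (by simpa using h1)
    simpa using this
  · cases x with
    | nil => simp at h4 ⊢; rw [← hp a b hab]; exact h4
    | cons c x => simpa using h4

open Polynomial in
lemma main_gam (d : ℕ) : ∀ W : Finset (List ℤ), SwapClosed W →
    (∀ w ∈ W, w.Nodup ∧ w.length = d ∧ ∀ a ∈ w.getLast?, a < 0) →
    ((∀ w ∈ W, ∀ a ∈ w.head?, ¬ a < 0) → gf W ∈ Gam d) ∧
    (d ≠ 0 → (∀ w ∈ W, ∀ a ∈ w.head?, a < 0) → gf W ∈ Gam (d - 1)) := by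
  induction d using Nat.strong_induction_on with
  | _ d ih =>
  intro W hcl hW
  have gen : ∀ (p : ℤ → Bool), (∀ a b : ℤ, (a < 0 ↔ b < 0) → p a = p b) →
      (∀ a b, p a = true → p b = true → (a < 0 ↔ b < 0)) →
      d ≠ 0 → (∀ w ∈ W, ∀ a ∈ w.head?, p a = true) →
      ∀ T ∈ W.image (fun w => (w.takeWhile p).toFinset),
      0 < T.card ∧ T.card ≤ d ∧ (∀ a ∈ T, p a = true) ∧ SwapClosed (sufF p W T) ∧
      (∀ w ∈ sufF p W T, w.Nodup ∧ w.length = d - T.card ∧ ∀ a ∈ w.getLast?, a < 0) ∧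
      (∀ w ∈ sufF p W T, ∀ a ∈ w.head?, p a = false) ∧
      ([] ∈ sufF p W T → ∃ a ∈ T, a < 0) := by
    intro p hp1 hp2 hd hhead T hT
    obtain ⟨w, hw, rfl⟩ := Finset.mem_image.1 hT
    obtain ⟨hwn, hwl, hwlast⟩ := hW w hw
    have hcard : (w.takeWhile p).toFinset.card = (w.takeWhile p).length :=
      List.toFinset_card_of_nodup (hwn.sublist (List.takeWhile_sublist p))
    refine ⟨?_, ?_, ?_, hcl.suf p hp1 _, ?_, ?_, ?_⟩
    · rw [hcard]
      cases w with
      | nil => simp at hwl; omega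
      | cons a w =>
        have := hhead _ hw a (by simp)
        simp [this]
    · rw [hcard, ← hwl]; exact (List.takeWhile_sublist p).length_le
    · intro a ha; rw [List.mem_toFinset] at ha; exact List.mem_takeWhile_imp ha
    · intro v hv
      obtain ⟨u, h1, h2, h3, h4⟩ := mem_sufF.1 hv
      obtain ⟨g1, g2, g3⟩ := hW _ h1
      have hun := (List.nodup_append.1 g1).1
      refine ⟨(List.nodup_append.1 g1).2.1, ?_, ?_⟩
      · rw [← h3, List.toFinset_card_of_nodup hun]; simp at g2; omega
      · intro a ha
        apply g3
        simp at ha ⊢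
        simp [ha]
    · intro v hv
      obtain ⟨u, h1, h2, h3, h4⟩ := mem_sufF.1 hv
      exact h4
    · intro hv
      obtain ⟨u, h1, h2, h3, h4⟩ := mem_sufF.1 hv
      obtain ⟨g1, g2, g3⟩ := hW _ h1
      rw [List.append_nil] at g2 g3
      rcases List.eq_nil_or_concat u with rfl | ⟨u, a, rfl⟩
      · simp at g2; omega
      · refine ⟨a, ?_, g3 a (by simp)⟩
        rw [← h3]; simp
  have hsplit : ∀ (p : ℤ → Bool), (∀ a b, p a = true → p b = true → (a < 0 ↔ b < 0)) →
      gf W = ∑ T ∈ W.image (fun w => (w.takeWhile p).toFinset),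
      ∑ u ∈ permsF T, ∑ v ∈ sufF p W T, X ^ desL (u ++ v) := by
    intro p hp2
    refine split_sum p W (fun w hw => (hW w hw).1) ?_ _
    intro u u' v hu hperm hmem
    exact hcl.perm hperm [] v (fun a ha b hb => hp2 a b (hu a ha) (hu b hb)) hmem
  constructor
  · intro hhead
    rcases Nat.eq_zero_or_pos d with rfl | hd
    · have : ∀ w ∈ W, (X : Polynomial ℕ) ^ desL w = 1 := by
        intro w hw
        have := List.length_eq_zero_iff.1 (hW w hw).2.1
        subst this; simp [desL]
      unfold gf
      rw [Finset.sum_congr rfl this]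
      exact (Gam 0).sum_mem fun _ _ => Gam_one
    · set p : ℤ → Bool := fun a => decide (¬ a < 0) with hp
      have hp1 : ∀ a b : ℤ, (a < 0 ↔ b < 0) → p a = p b := by intro a b h; simp only [hp, h]
      have hp2 : ∀ a b, p a = true → p b = true → (a < 0 ↔ b < 0) := by
        intro a b ha hb
        have ha' : ¬ a < 0 := of_decide_eq_true ha
        have hb' : ¬ b < 0 := of_decide_eq_true hb
        tauto
      have G := gen p hp1 hp2 (by omega) (fun w hw a ha => decide_eq_true (hhead w hw a ha))
      rw [hsplit p hp2]
      refine (Gam d).sum_mem fun T hT => ?_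
      obtain ⟨t1, t2, t3, t4, t5, t6, t7⟩ := G T hT
      have ht3 : ∀ a ∈ T, ¬ a < 0 := fun a ha => of_decide_eq_true (t3 a ha)
      have t6' : ∀ w ∈ sufF p W T, ∀ a ∈ w.head?, a < 0 := by
        intro w hw a ha
        have := of_decide_eq_false (t6 w hw a ha)
        exact not_not.1 this
      have tnil : [] ∉ sufF p W T := by
        intro h; obtain ⟨a, ha, ha'⟩ := t7 h; exact ht3 a ha ha'
      rcases (sufF p W T).eq_empty_or_nonempty with he | ⟨v0, hv0⟩
      · rw [he]; simp
      have hdT : d - T.card ≠ 0 := by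
        intro h
        have := (t5 v0 hv0).2.1
        rw [h] at this
        rw [List.length_eq_zero_iff.1 this] at hv0
        exact tnil hv0
      have e2 := (ih (d - T.card) (by omega) _ t4 t5).2 hdT t6'
      have e1 := Eul_mem (T.card - 1) T (by omega)
      have := Gam_mul (K := d) e1 (Gam_mul Gam_X e2 rfl) (by omega)
      convert this using 1
      unfold gf
      rw [Finset.sum_mul]
      refine Finset.sum_congr rfl fun u hu => ?_
      rw [Finset.mul_sum, Finset.mul_sum]
      refine Finset.sum_congr rfl fun v hv => ?_
      obtain ⟨hun, huT⟩ := mem_permsF.1 hu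
      rw [desL_desc]
      · ring
      · rintro rfl; simp at huT; rw [← huT] at t1; simp at t1
      · rintro rfl; exact tnil hv
      · intro a ha b hb
        have hb' := t6' v hv b hb
        rw [← List.mem_toFinset, huT] at ha
        have := ht3 a ha
        omega
  · intro hd hhead
    set p : ℤ → Bool := fun a => decide (a < 0) with hp
    have hp1 : ∀ a b : ℤ, (a < 0 ↔ b < 0) → p a = p b := by intro a b h; simp only [hp, h]
    have hp2 : ∀ a b, p a = true → p b = true → (a < 0 ↔ b < 0) := by
      intro a b ha hb
      have ha' : a < 0 := of_decide_eq_true ha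
      have hb' : b < 0 := of_decide_eq_true hb
      tauto
    have G := gen p hp1 hp2 (by omega) (fun w hw a ha => decide_eq_true (hhead w hw a ha))
    rw [hsplit p hp2]
    refine (Gam (d - 1)).sum_mem fun T hT => ?_
    obtain ⟨t1, t2, t3, t4, t5, t6, t7⟩ := G T hT
    have ht3 : ∀ a ∈ T, a < 0 := fun a ha => of_decide_eq_true (t3 a ha)
    have t6' : ∀ w ∈ sufF p W T, ∀ a ∈ w.head?, ¬ a < 0 := by
      intro w hw a ha
      exact of_decide_eq_false (t6 w hw a ha)
    have e2 := (ih (d - T.card) (by omega) _ t4 t5).1 t6'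
    have e1 := Eul_mem (T.card - 1) T (by omega)
    have := Gam_mul (K := d - 1) e1 e2 (by omega)
    convert this using 1
    unfold gf
    rw [Finset.sum_mul]
    refine Finset.sum_congr rfl fun u hu => ?_
    rw [Finset.mul_sum]
    refine Finset.sum_congr rfl fun v hv => ?_
    obtain ⟨hun, huT⟩ := mem_permsF.1 hu
    rw [desL_asc]
    · ring
    · intro a ha b hb
      have hb' := t6' v hv b hb
      rw [← List.mem_toFinset, huT] at ha
      have := ht3 a ha
      omega

lemma desL_ofFn (n : ℕ) : ∀ π : Fin (n + 1) → ℤ, π (Fin.last n) < 0 →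
    (∑ i : Fin (n + 1), if (∃ h : (i : ℕ) + 1 < n + 1, π ⟨(i : ℕ) + 1, h⟩ < π i) ∨
      ((i : ℕ) + 1 = n + 1 ∧ 0 < π i) then 1 else 0) = desL (List.ofFn π) := by
  induction n with
  | zero =>
    intro π h
    have h0 : ¬ 0 < π 0 := by have : π 0 < 0 := h; omega
    rw [Fin.sum_univ_one, if_neg]
    · rfl
    · rintro (⟨h, _⟩ | ⟨_, h⟩)
      · simp at h
      · exact h0 h
  | succ n ih =>
    intro π h
    have := ih (fun i => π i.succ) (by simpa using h)
    rw [Fin.sum_univ_succ, List.ofFn_succ, List.ofFn_succ, desL]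
    rw [List.ofFn_succ] at this
    rw [← this]
    congr 1
    · apply if_congr _ rfl rfl
      constructor
      · rintro (⟨_, h⟩ | ⟨h, _⟩)
        · exact h
        · simp at h
      · intro h; exact Or.inl ⟨by simp, h⟩
    · refine Finset.sum_congr rfl fun i _ => ?_
      simp only [Fin.val_succ, Nat.add_lt_add_iff_right, Nat.add_right_cancel_iff, Fin.succ_mk]

/-- accumulator form of the precedence condition -/
def validL (R : ℤ → ℤ → Prop) : Set ℤ → List ℤ → Prop
  | _, [] => True
  | S, a :: l => (∀ b, R a b → b ∈ S) ∧ validL R (insert a S) l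

lemma validL_swap (R : ℤ → ℤ → Prop) (hR : ∀ a b, R a b → ¬ a < 0 ∧ b < 0) (a b : ℤ)
    (hab : a < 0 ↔ b < 0) (v : List ℤ) (u : List ℤ) : ∀ S, validL R S (u ++ a :: b :: v) →
      validL R S (u ++ b :: a :: v) := by
  induction u with
  | nil =>
    rintro S ⟨h1, h2, h3⟩
    refine ⟨fun c hc => ?_, fun c hc => Or.inr (h1 c hc), ?_⟩
    · rcases h2 c hc with rfl | h
      · have := hR _ _ hc; tauto
      · exact h
    · rwa [Set.insert_comm]
  | cons c u ih =>
    rintro S ⟨h1, h2⟩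
    exact ⟨h1, ih _ h2⟩

lemma validL_iff (R : ℤ → ℤ → Prop) (w : List ℤ) : ∀ S, validL R S w ↔
    ∀ k (h : k < w.length) b, R w[k] b → b ∈ S ∨ ∃ q, ∃ hq : q < k, w[q] = b := by
  induction w with
  | nil => intro S; simp [validL]
  | cons a l ih =>
    intro S
    simp only [validL, ih]
    constructor
    · rintro ⟨h1, h2⟩ k hk b hb
      cases k with
      | zero => exact Or.inl (h1 b hb)
      | succ k =>
        rcases h2 k (by simpa using hk) b (by simpa using hb) with (rfl | h) | ⟨q, hq, h⟩
        · exact Or.inr ⟨0, by omega, by simp⟩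
        · exact Or.inl h
        · exact Or.inr ⟨q + 1, by omega, by simpa using h⟩
    · intro h
      refine ⟨fun b hb => ?_, fun k hk b hb => ?_⟩
      · rcases h 0 (by simp) b hb with h | ⟨q, hq, _⟩
        · exact h
        · omega
      · rcases h (k + 1) (by simpa using hk) b (by simpa using hb) with h | ⟨q, hq, h⟩
        · exact Or.inl (Or.inr h)
        · cases q with
          | zero => left; left; simpa using h.symm
          | succ q => exact Or.inr ⟨q, by omega, by simpa using h⟩

def RG {d : ℕ} (G : SimpleGraph (Fin d)) (a b : ℤ) : Prop :=
  ∃ i j : Fin d, G.Adj i j ∧ a = ((i : ℕ) + 1 : ℤ) ∧ b = -(((j : ℕ) + 1 : ℤ))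

lemma RG_sign {d : ℕ} (G : SimpleGraph (Fin d)) (a b : ℤ) (h : RG G a b) : ¬ a < 0 ∧ b < 0 := by
  obtain ⟨i, j, _, rfl, rfl⟩ := h
  omega

def GoodL {d : ℕ} (G : SimpleGraph (Fin d)) (w : List ℤ) : Prop :=
  w.length = d ∧ (∀ a ∈ w, 1 ≤ a.natAbs ∧ a.natAbs ≤ d) ∧ (w.map Int.natAbs).Nodup ∧
    validL (RG G) ∅ w ∧ ∀ a ∈ w.getLast?, a < 0

lemma good_ofFn {n : ℕ} (G : SimpleGraph (Fin (n + 1))) (π : Fin (n + 1) → ℤ) :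
    GoodL G (List.ofFn π) ↔ π ∈ PiSet G ∧ π (Fin.last n) < 0 := by
  unfold GoodL PiSet IsSignedPermWord
  have h1 : (List.map Int.natAbs (List.ofFn π)).Nodup ↔
      Function.Injective fun p => (π p).natAbs := by
    rw [List.map_ofFn, List.nodup_ofFn]; rfl
  have h2 : (∀ a ∈ (List.ofFn π).getLast?, a < 0) ↔ π (Fin.last n) < 0 := by
    rw [List.getLast?_eq_getElem?]
    simp [List.getElem?_ofFn, Fin.last, -List.ofFn_succ]
  have h3 : validL (RG G) ∅ (List.ofFn π) ↔ ∀ i j : Fin (n + 1), G.Adj i j →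
    ∀ p : Fin (n + 1), π p = ((i : ℕ) + 1 : ℤ) →
      ∃ q : Fin (n + 1), q < p ∧ π q = -(((j : ℕ) + 1 : ℤ)) := by
    rw [validL_iff]
    constructor
    · intro h i j hij p hp
      rcases h p (by rw [List.length_ofFn]; exact p.2) (-(((j : ℕ) + 1 : ℤ)))
        ⟨i, j, hij, by simpa [-List.ofFn_succ] using hp, rfl⟩ with h | ⟨q, hq, h⟩
      · exact absurd h (Set.notMem_empty _)
      · exact ⟨⟨q, by omega⟩, hq, by simpa [-List.ofFn_succ] using h⟩
    · rintro h k hk b ⟨i, j, hij, hp, rfl⟩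
      right
      obtain ⟨q, hq, h⟩ := h i j hij ⟨k, by simpa using hk⟩ (by simpa [-List.ofFn_succ] using hp)
      exact ⟨q, hq, by simpa [-List.ofFn_succ] using h⟩
  rw [h1, h2, h3]
  simp only [List.length_ofFn, List.forall_mem_ofFn_iff, Set.mem_setOf_eq]
  tauto

lemma good_swap {d : ℕ} (G : SimpleGraph (Fin d)) (u : List ℤ) (a b : ℤ) (v : List ℤ)
    (hab : a < 0 ↔ b < 0) (h : GoodL G (u ++ a :: b :: v)) : GoodL G (u ++ b :: a :: v) := by
  obtain ⟨h1, h2, h3, h4, h5⟩ := h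
  have hp : (u ++ a :: b :: v).Perm (u ++ b :: a :: v) :=
    List.Perm.append_left u (List.Perm.swap b a v)
  refine ⟨by rw [← hp.length_eq, h1], fun c hc => h2 c (hp.mem_iff.2 hc),
    ((hp.map _).nodup_iff).1 h3, validL_swap _ (RG_sign G) a b hab v u _ h4, ?_⟩
  cases v with
  | nil => simp at h5 ⊢; exact hab.2 h5
  | cons c v => simpa [List.getLast?_cons_cons] using h5

/-- the descent generating numbers of `Π_−` (words in `Π(G)` with
negative last letter) are symmetric and unimodal. -/
theorem stmt3 (d : ℕ) (hd : 2 ≤ d) (G : SimpleGraph (Fin d))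
    (hiso : ∀ i : Fin d, ∃ j, G.Adj i j) (v : ℕ → ℕ)
    (hv : ∀ i, v i = Set.ncard {π : Fin d → ℤ |
      π ∈ PiSet G ∧ π ⟨d - 1, by omega⟩ < 0 ∧ des π = i}) :
    (∀ i ≤ d - 1, v i = v (d - 1 - i)) ∧
      (∀ i, i + 1 ≤ (d - 1) / 2 → v i ≤ v (i + 1)) := by
  obtain ⟨n, rfl⟩ : ∃ n, d = n + 1 := ⟨d - 1, by omega⟩
  have hlast : ∀ π : Fin (n + 1) → ℤ, π ⟨n + 1 - 1, by omega⟩ = π (Fin.last n) := fun π => rfl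
  have hfin : {π : Fin (n + 1) → ℤ | π ∈ PiSet G ∧ π (Fin.last n) < 0}.Finite := by
    refine (Set.Finite.pi' (fun _ : Fin (n + 1) =>
      Set.finite_Icc (-((n : ℤ) + 1)) ((n : ℤ) + 1))).subset ?_
    rintro π ⟨⟨⟨h, _⟩, _⟩, _⟩ p
    have := (h p).2
    simp only [Set.mem_Icc]
    omega
  classical
  set W : Finset (List ℤ) := hfin.toFinset.image List.ofFn with hWdef
  have hinj : Function.Injective (fun π : Fin (n + 1) → ℤ => List.ofFn π) := List.ofFn_injective
  have hW : ∀ w, w ∈ W ↔ GoodL G w := by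
    intro w
    rw [hWdef, Finset.mem_image]
    constructor
    · rintro ⟨π, hπ, rfl⟩
      rw [good_ofFn]; simpa using hπ
    · intro h
      have hl := h.1
      have he : List.ofFn (fun i : Fin (n + 1) => w[i.1]'(by omega)) = w := by
        apply List.ext_getElem
        · simp [hl]
        · intro i h1 h2; simp [-List.ofFn_succ]
      refine ⟨_, ?_, he⟩
      rw [Set.Finite.mem_toFinset, Set.mem_setOf_eq, ← good_ofFn, he]
      exact h
  have hgam : gf W ∈ Gam (n + 1 - 1) := by
    refine (main_gam (n + 1) W ?_ ?_).2 (by omega) ?_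
    · intro u a b v hab hw
      rw [hW] at hw ⊢
      exact good_swap G u a b v hab hw
    · intro w hw
      rw [hW] at hw
      exact ⟨List.Nodup.of_map _ hw.2.2.1, hw.1, hw.2.2.2.2⟩
    · intro w hw a ha
      rw [hW] at hw
      obtain ⟨h1, h2, h3, h4, h5⟩ := hw
      cases w with
      | nil => simp at h1
      | cons c w =>
        simp at ha
        subst ha
        by_contra hneg
        have hb := h2 c (by simp)
        obtain ⟨j, hj⟩ := hiso ⟨c.natAbs - 1, by omega⟩
        exact absurd (h4.1 _ ⟨_, j, hj, by simp; omega, rfl⟩) (Set.notMem_empty _)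
  have hcoef : ∀ i, v i = (gf W).coeff i := by
    intro i
    have hdes : ∀ π : Fin (n + 1) → ℤ, π (Fin.last n) < 0 → des π = desL (List.ofFn π) := by
      intro π hπ
      rw [← desL_ofFn n π hπ, ← Finset.card_filter, des, ← Set.ncard_coe_finset]
      congr 1
      ext i; simp
    rw [hv i, gf, Polynomial.finset_sum_coeff, hWdef, Finset.sum_image (fun _ _ _ _ h => hinj h)]
    simp only [Polynomial.coeff_X_pow]
    rw [← Finset.card_filter, ← Set.ncard_coe_finset]
    congr 1
    ext π
    simp only [Set.mem_setOf_eq, Finset.coe_filter, Set.Finite.mem_toFinset, hlast]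
    constructor
    · rintro ⟨h1, h2, h3⟩; exact ⟨⟨h1, h2⟩, by rw [← hdes π h2, h3]⟩
    · rintro ⟨⟨h1, h2⟩, h3⟩; exact ⟨h1, h2, by rw [hdes π h2, ← h3]⟩
  obtain ⟨s1, s2⟩ := Gam_spec hgam
  simp only [hcoef]
  exact ⟨s1, s2⟩
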